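/- arXiv:2410.09830 — 2 statements merged into one kernel-verified Lean document; each statement's English description precedes it below -/
import Mathlib

section
/- Let G be a simple graph on n vertices, let e be an edge of G and H = G − e, and let λ_1 ≥ ⋯ ≥ λ_n and θ_1 ≥ ⋯ ≥ θ_n denote the eigenvalues of the adjacency matrices A(G) and A(H), respectively. If H has at least two positive eigenvalues, then s^+(G) ≥ s^+(H) − θ_2^2 when θ_2 < 1, and s^+(G) ≥ s^+(H) − 2θ_2 + 1 when θ_2 ≥ 1. -/
open Polynomial

/-- Adjacency matrix of a simple graph over ℝ (using classical decidability). -/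
noncomputable def adjMat {V : Type*} [Fintype V] (G : SimpleGraph V) : Matrix V V ℝ :=
  letI := Classical.decRel G.Adj
  SimpleGraph.adjMatrix ℝ G

/-- Positive square energy: the sum of the squares of the positive adjacency eigenvalues. -/
noncomputable def sPlus {V : Type*} [Fintype V] [DecidableEq V] (G : SimpleGraph V) : ℝ :=
  (((adjMat G).charpoly.roots.filter (fun x : ℝ => 0 < x)).map (fun x : ℝ => x ^ 2)).sum

open Matrix

/-- Abstract spectral data. -/
def SpecData {n : ℕ} (A : Matrix (Fin n) (Fin n) ℝ) (α : ℕ → ℝ) : Prop :=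
  ∃ c : Fin n → ((Fin n → ℝ) →ₗ[ℝ] ℝ), (∀ x, ∑ i, c i x ^ 2 = x ⬝ᵥ x) ∧
    ∀ x, x ⬝ᵥ A *ᵥ x = ∑ i : Fin n, α i * c i x ^ 2

lemma exists_spec {n : ℕ} (hn : 0 < n) (A : Matrix (Fin n) (Fin n) ℝ) (hA : A.IsHermitian) :
    ∃ μ : ℕ → ℝ, Antitone μ ∧ SpecData A μ ∧ A.charpoly.roots = (Multiset.range n).map μ := by
  classical
  set ev := hA.eigenvalues with hev
  set σ := Tuple.sort (fun i => - ev i) with hσ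
  have hmono : Antitone (ev ∘ σ) := by
    intro i j hij
    have := Tuple.monotone_sort (fun i => - ev i) hij
    simpa using this
  have hval : ∀ i : Fin n, (ev ∘ σ) ⟨min i.1 (n-1), by omega⟩ = ev (σ i) := by
    intro i
    have : (⟨min i.1 (n-1), by omega⟩ : Fin n) = i := by ext; simp; omega
    rw [this]; rfl
  refine ⟨fun i => (ev ∘ σ) ⟨min i (n-1), by omega⟩, ?_, ?_, ?_⟩
  · intro i j hij
    exact hmono (by simp only [Fin.mk_le_mk]; omega)
  · set U : Matrix (Fin n) (Fin n) ℝ := (hA.eigenvectorUnitary : Matrix (Fin n) (Fin n) ℝ) with hU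
    have hUU : U * Uᵀ = 1 := by
      have := Unitary.mul_star_self_of_mem hA.eigenvectorUnitary.2
      simpa [Matrix.star_eq_conjTranspose] using this
    have hsp : A = U * diagonal ev * Uᵀ := by
      have := hA.spectral_theorem
      rw [Unitary.conjStarAlgAut_apply] at this
      simpa [Matrix.star_eq_conjTranspose, Function.comp_def] using this
    refine ⟨fun i => LinearMap.proj (σ i) ∘ₗ Matrix.mulVecLin Uᵀ, ?_, ?_⟩
    · intro x
      simp only [LinearMap.comp_apply, LinearMap.proj_apply, Matrix.mulVecLin_apply]
      rw [Equiv.sum_comp σ (fun i => ((Uᵀ *ᵥ x) i)^2)]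
      have : x ⬝ᵥ x = (Uᵀ *ᵥ x) ⬝ᵥ (Uᵀ *ᵥ x) := by
        rw [Matrix.dotProduct_mulVec, Matrix.vecMul_transpose, Matrix.mulVec_mulVec, hUU,
          Matrix.one_mulVec]
      rw [this]
      simp [dotProduct, pow_two]
    · intro x
      simp only [LinearMap.comp_apply, LinearMap.proj_apply, Matrix.mulVecLin_apply, hval]
      rw [Equiv.sum_comp σ (fun i => ev i * ((Uᵀ *ᵥ x) i)^2)]
      have : x ⬝ᵥ A *ᵥ x = (Uᵀ *ᵥ x) ⬝ᵥ (diagonal ev *ᵥ (Uᵀ *ᵥ x)) := by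
        conv_lhs => rw [hsp]
        rw [← Matrix.mulVec_mulVec, ← Matrix.mulVec_mulVec, Matrix.dotProduct_mulVec x U,
          Matrix.mulVec_transpose]
      rw [this]
      simp only [dotProduct, Matrix.mulVec_diagonal]
      exact Finset.sum_congr rfl fun i _ => by ring
  · rw [hA.roots_charpoly_eq_eigenvalues]
    have e1 : Multiset.range n = (Finset.univ.val).map (fun i : Fin n => (i : ℕ)) := by
      rw [Fin.univ_val_map, List.ofFn_eq_map, List.map_coe_finRange_eq_range]
      rfl
    rw [e1, Multiset.map_map]
    have e2 : (Finset.univ.val : Multiset (Fin n)) = (Finset.univ.val).map σ := by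
      conv_lhs => rw [← Finset.map_univ_equiv σ]
      rfl
    conv_lhs => rw [e2]
    rw [Multiset.map_map]
    refine Multiset.map_congr rfl fun i _ => ?_
    exact (hval i).symm

lemma specData_of_roots {n : ℕ} (hn : 0 < n) (A : Matrix (Fin n) (Fin n) ℝ) (hA : A.IsHermitian)
    (α : ℕ → ℝ) (hα : Antitone α)
    (h : A.charpoly.roots = (Multiset.range n).map α) : SpecData A α := by
  obtain ⟨μ, hμ, ⟨c, hc, hq⟩, hr⟩ := exists_spec hn A hA
  rw [h] at hr
  have hp : ((List.range n).map α).Perm ((List.range n).map μ) := by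
    rw [← Multiset.coe_eq_coe]
    exact hr
  have hs : ∀ γ : ℕ → ℝ, Antitone γ → ((List.range n).map γ).SortedGE := by
    intro γ hγ
    rw [List.sortedGE_iff_pairwise, List.pairwise_map]
    exact List.pairwise_lt_range.imp fun hab => hγ hab.le
  have he := List.Perm.eq_of_sortedGE (hs α hα) (hs μ hμ) hp
  have hv : ∀ i < n, α i = μ i := by
    intro i hi
    exact List.map_inj_left.mp he i (List.mem_range.mpr hi)
  refine ⟨c, hc, fun x => ?_⟩
  rw [hq x]
  exact Finset.sum_congr rfl fun i _ => by rw [hv i i.2]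

lemma trace_of_roots {n : ℕ} (A : Matrix (Fin n) (Fin n) ℝ) (hA : A.IsHermitian) (α : ℕ → ℝ)
    (h : A.charpoly.roots = (Multiset.range n).map α) :
    A.trace = ∑ i ∈ Finset.range n, α i := by
  rw [Matrix.trace_eq_sum_roots_charpoly_of_splits hA.splits_charpoly, h]
  rfl

lemma numeric (m : ℕ) (θ μ lam : ℕ → ℝ) 
    (h1 : ∀ i < m + 2, μ i ≤ θ i) (h2 : ∀ i, i + 1 < m + 2 → θ (i+1) ≤ μ i)
    (h3 : ∀ i < m + 2, μ i ≤ lam i) (h0 : θ 0 ≤ lam 0)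
    (hs : ∑ i ∈ Finset.range (m+2), (θ i - μ i) = 1) (c : ℝ) (hc : 0 ≤ c) (hc' : c ≤ θ 1) :
    ∑ i ∈ Finset.range (m+2), (max (θ i) 0)^2 ≤
    ∑ i ∈ Finset.range (m+2), (max (lam i) 0)^2 + 2 * c + (θ 1 - c)^2 := by
  have key : ∀ x y : ℝ, y ≤ x → (max x 0)^2 - (max y 0)^2 ≤
      2 * c * (x - y) + ((max (x - c) 0)^2 - (max (y-c) 0)^2) := by
    intro x y hxy
    rcases max_cases x 0 with ⟨e1, g1⟩ | ⟨e1, g1⟩ <;>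
    rcases max_cases y 0 with ⟨e2, g2⟩ | ⟨e2, g2⟩ <;>
    rcases max_cases (x-c) 0 with ⟨e3, g3⟩ | ⟨e3, g3⟩ <;>
    rcases max_cases (y-c) 0 with ⟨e4, g4⟩ | ⟨e4, g4⟩ <;>
    rw [e1, e2, e3, e4] <;> nlinarith
  have mono : ∀ x y : ℝ, y ≤ x → (max y 0)^2 ≤ (max x 0)^2 := by
    intro x y hxy
    have := max_le_max_right 0 hxy
    exact pow_le_pow_left₀ (le_max_right _ _) this 2
  have tel : ∀ k ≤ m+1, ∑ i ∈ Finset.range k, ((max (θ (i+1) - c) 0)^2 - (max (μ (i+1) - c) 0)^2)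
     ≤ (max (θ 1 - c) 0)^2 - (if k = 0 then (max (θ 1 - c) 0)^2 else (max (μ k - c) 0)^2) := by
    intro k
    induction k with
    | zero => simp
    | succ k ih =>
      intro hk
      have := ih (by omega)
      rw [Finset.sum_range_succ]
      rcases k with _ | k
      · simp
      · have h := mono (μ (k+1) - c) (θ (k+1+1) - c) (by linarith [h2 (k+1) (by omega)])
        simp at this ⊢
        linarith
  have tel' := tel (m+1) le_rfl
  simp only [Nat.add_eq_zero_iff, one_ne_zero, and_false, if_false] at tel'
  rw [max_eq_left (by linarith : 0 ≤ θ 1 - c)] at tel'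
  rw [Finset.sum_range_succ'] at hs ⊢
  rw [Finset.sum_range_succ' (fun i => (max (lam i) 0)^2)]
  have a1 := mono (lam 0) (θ 0) h0
  have a2 : ∑ i ∈ Finset.range (m+1), (max (μ (i+1)) 0)^2 ≤ ∑ i ∈ Finset.range (m+1), (max (lam (i+1)) 0)^2 :=
    Finset.sum_le_sum fun i hi => mono _ _ (h3 _ (by simp at hi; omega))
  have a3 := Finset.sum_le_sum (s := Finset.range (m+1)) fun i hi => key (θ (i+1)) (μ (i+1)) (h1 _ (by simp at hi; omega))
  rw [Finset.sum_add_distrib, ← Finset.mul_sum, Finset.sum_sub_distrib] at a3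
  have a4 := h1 0 (by omega)
  have a5 : 2 * c * ∑ i ∈ Finset.range (m+1), (θ (i+1) - μ (i+1)) ≤ 2 * c * 1 :=
    mul_le_mul_of_nonneg_left (by linarith) (by linarith)
  have a6 := sq_nonneg (max (μ (m+1) - c) 0)
  linarith

lemma exists_ker {V ι : Type*} [AddCommGroup V] [Module ℝ V] [FiniteDimensional ℝ V] [Fintype ι]
    (f : ι → V →ₗ[ℝ] ℝ) (h : Fintype.card ι < Module.finrank ℝ V) : ∃ x, x ≠ 0 ∧ ∀ i, f i x = 0 := by
  have := (LinearMap.pi f).ker_ne_bot_of_finrank_lt (by simpa using h)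
  obtain ⟨x, hx, hx0⟩ := (Submodule.ne_bot_iff _).mp this
  exact ⟨x, hx0, fun i => congrFun (LinearMap.mem_ker.mp hx) i⟩

lemma weyl {n : ℕ} (A B : Matrix (Fin n) (Fin n) ℝ) (α β : ℕ → ℝ) (hα : Antitone α) (hβ : Antitone β)
    (hA : SpecData A α) (hB : SpecData B β) (k : ℕ) (L : Fin k → (Fin n → ℝ) →ₗ[ℝ] ℝ)
    (h : ∀ x, (∀ j, L j x = 0) → x ⬝ᵥ A *ᵥ x ≤ x ⬝ᵥ B *ᵥ x) (i : ℕ) (hi : i + k < n) :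
    α (i + k) ≤ β i := by
  obtain ⟨c, hc, hqA⟩ := hA
  obtain ⟨d, hd, hqB⟩ := hB
  obtain ⟨x, hx0, hx⟩ := exists_ker (V := Fin n → ℝ)
    (ι := (Fin (n - (i + k + 1)) ⊕ Fin i) ⊕ Fin k)
    (Sum.elim (Sum.elim (fun j => c ⟨i + k + 1 + j, by omega⟩) (fun j => d ⟨j, by omega⟩)) L)
    (by simp; omega)
  have hxc : ∀ j : Fin n, i + k < j → c j x = 0 := by
    intro j hj
    have := hx (Sum.inl (Sum.inl ⟨j - (i+k+1), by omega⟩))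
    simp only [Sum.elim_inl] at this
    convert this using 3
    ext; simp; omega
  have hxd : ∀ j : Fin n, j < i → d j x = 0 := by
    intro j hj
    exact hx (Sum.inl (Sum.inr ⟨j, hj⟩))
  have hq := h x fun j => hx (Sum.inr j)
  have hpos : 0 < x ⬝ᵥ x := by
    have := Matrix.dotProduct_star_self_pos_iff.mpr hx0
    rwa [star_trivial] at this
  have e1 : α (i+k) * (x ⬝ᵥ x) ≤ x ⬝ᵥ A *ᵥ x := by
    rw [hqA, ← hc, Finset.mul_sum]
    refine Finset.sum_le_sum fun j _ => ?_
    by_cases hj : i + k < j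
    · simp [hxc j hj]
    · exact mul_le_mul_of_nonneg_right (hα (by omega)) (sq_nonneg _)
  have e2 : x ⬝ᵥ B *ᵥ x ≤ β i * (x ⬝ᵥ x) := by
    rw [hqB, ← hd, Finset.mul_sum]
    refine Finset.sum_le_sum fun j _ => ?_
    by_cases hj : j < i
    · simp [hxd j hj]
    · exact mul_le_mul_of_nonneg_right (hβ (by omega)) (sq_nonneg _)
  exact le_of_mul_le_mul_right (e1.trans (hq.trans e2)) hpos

lemma top_eig {n : ℕ} (A B : Matrix (Fin n) (Fin n) ℝ) (α β : ℕ → ℝ) (hα : Antitone α) (hβ : Antitone β)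
    (hA : SpecData A α) (hB : SpecData B β) (hn : 0 < n) (T : (Fin n → ℝ) → (Fin n → ℝ))
    (hT : ∀ x, T x ⬝ᵥ T x = x ⬝ᵥ x)
    (h : ∀ x, x ⬝ᵥ A *ᵥ x ≤ T x ⬝ᵥ B *ᵥ T x) : α 0 ≤ β 0 := by
  obtain ⟨c, hc, hqA⟩ := hA
  obtain ⟨d, hd, hqB⟩ := hB
  obtain ⟨x, hx0, hx⟩ := exists_ker (V := Fin n → ℝ)
    (fun j : Fin (n - 1) => c ⟨j + 1, by omega⟩) (by simp; omega)
  have hpos : 0 < x ⬝ᵥ x := by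
    have := Matrix.dotProduct_star_self_pos_iff.mpr hx0
    rwa [star_trivial] at this
  have e1 : α 0 * (x ⬝ᵥ x) ≤ x ⬝ᵥ A *ᵥ x := by
    rw [hqA, ← hc, Finset.mul_sum]
    refine Finset.sum_le_sum fun j _ => ?_
    by_cases hj : 0 < (j : ℕ)
    · have : c j x = 0 := by
        have := hx ⟨j - 1, by omega⟩
        convert this using 3
        ext; simp; omega
      simp [this]
    · exact mul_le_mul_of_nonneg_right (hα (by omega)) (sq_nonneg _)
  have e2 : T x ⬝ᵥ B *ᵥ T x ≤ β 0 * (x ⬝ᵥ x) := by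
    rw [hqB, ← hT, ← hd, Finset.mul_sum]
    exact Finset.sum_le_sum fun j _ => mul_le_mul_of_nonneg_right (hβ (by omega)) (sq_nonneg _)
  exact le_of_mul_le_mul_right (e1.trans ((h x).trans e2)) hpos

lemma sPlus_eq {n : ℕ} (G : SimpleGraph (Fin n)) (α : ℕ → ℝ)
    (h : (adjMat G).charpoly.roots = (Multiset.range n).map α) :
    sPlus G = ∑ i ∈ Finset.range n, (max (α i) 0)^2 := by
  have : ∀ s : Multiset ℝ, ((s.filter (fun x : ℝ => 0 < x)).map (fun x : ℝ => x ^ 2)).sum =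
      (s.map (fun x => (max x 0)^2)).sum := by
    intro s
    induction s using Multiset.induction_on with
    | empty => simp
    | cons a s ih =>
      by_cases ha : 0 < a
      · simp [ha, ih, max_eq_left ha.le]
      · simp [ha, ih, max_eq_right (not_lt.mp ha)]
  rw [sPlus, this, h, Multiset.map_map]
  rfl

lemma quad_form {n : ℕ} (A : Matrix (Fin n) (Fin n) ℝ) (x : Fin n → ℝ) :
    x ⬝ᵥ A *ᵥ x = ∑ i, ∑ j, A i j * (x i * x j) := by
  simp only [dotProduct, mulVec, Finset.mul_sum]
  exact Finset.sum_congr rfl fun i _ => Finset.sum_congr rfl fun j _ => by ring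

lemma quad_rank_one {n : ℕ} (w x : Fin n → ℝ) :
    x ⬝ᵥ (vecMulVec w w) *ᵥ x = (w ⬝ᵥ x) ^ 2 := by
  rw [vecMulVec_mulVec]
  simp [dotProduct_comm, pow_two]

lemma adjMat_herm {n : ℕ} (G : SimpleGraph (Fin n)) : (adjMat G).IsHermitian := by
  ext i j
  by_cases h : G.Adj i j
  · simp [adjMat, SimpleGraph.adjMatrix_apply, h, h.symm]
  · have h' : ¬ G.Adj j i := fun hh => h hh.symm
    simp [adjMat, SimpleGraph.adjMatrix_apply, h, h']

lemma adjMat_delete {n : ℕ} (G : SimpleGraph (Fin n)) (u v : Fin n) (huv : G.Adj u v) :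
    adjMat G = adjMat (G.deleteEdges {s(u,v)}) - (1/2 : ℝ) • vecMulVec (Pi.single u 1 - Pi.single v 1) (Pi.single u 1 - Pi.single v 1)
      + (1/2 : ℝ) • vecMulVec (Pi.single u 1 + Pi.single v 1) (Pi.single u 1 + Pi.single v 1) := by
  have hne := huv.ne
  ext i j
  simp only [adjMat, SimpleGraph.adjMatrix_apply, Matrix.add_apply, Matrix.sub_apply,
    Matrix.smul_apply, vecMulVec_apply, Pi.add_apply, Pi.sub_apply, Pi.single_apply,
    SimpleGraph.deleteEdges_adj, Set.mem_singleton_iff, Sym2.eq_iff, smul_eq_mul]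
  by_cases h1 : i = u <;> by_cases h2 : j = v <;> by_cases h3 : i = v <;> by_cases h4 : j = u <;>
    by_cases h5 : G.Adj i j <;> first
    | (exfalso; subst_vars; simp_all [G.adj_comm]; done)
    | (simp [h1, h2, h3, h4, h5] <;> norm_num <;> simp_all <;> norm_num)

lemma abs_quad {n : ℕ} (G H : SimpleGraph (Fin n)) (hle : H ≤ G) (x : Fin n → ℝ) :
    x ⬝ᵥ adjMat H *ᵥ x ≤ (fun i => |x i|) ⬝ᵥ adjMat G *ᵥ (fun i => |x i|) := by
  rw [quad_form, quad_form]
  refine Finset.sum_le_sum fun i _ => Finset.sum_le_sum fun j _ => ?_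
  simp only [adjMat, SimpleGraph.adjMatrix_apply, ← abs_mul]
  by_cases h : H.Adj i j
  · rw [if_pos h, if_pos (hle h), one_mul, one_mul]
    exact le_abs_self _
  · simp only [h, if_false, zero_mul]
    positivity

/-- Let `G` be a simple graph on `n` vertices, `e ∈ E(G)`, `H = G - e`,
with `lam` and `θ` the nonincreasing lists of eigenvalues of `A(G)` and `A(H)` (0-indexed,
so `θ 1` is the second largest eigenvalue θ₂ of `H`). If `H` has at least two positive
eigenvalues, then `s⁺(G) ≥ s⁺(H) - θ₂²` when `θ₂ < 1`, and `s⁺(G) ≥ s⁺(H) - 2θ₂ + 1`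
when `θ₂ ≥ 1`. -/
theorem positive_square_energy_edge_deletion {n : ℕ}
    (G H : SimpleGraph (Fin n)) (e : Sym2 (Fin n)) (he : e ∈ G.edgeSet)
    (hH : H = G.deleteEdges {e})
    (lam θ : ℕ → ℝ) (hlam_mono : Antitone lam) (hθ_mono : Antitone θ)
    (hlam : (adjMat G).charpoly.roots = (Multiset.range n).map lam)
    (hθ : (adjMat H).charpoly.roots = (Multiset.range n).map θ)
    (hn : 2 ≤ n) (hpos : 0 < θ 1) :
    (θ 1 < 1 → sPlus G ≥ sPlus H - θ 1 ^ 2) ∧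
    (1 ≤ θ 1 → sPlus G ≥ sPlus H - 2 * θ 1 + 1) := by
  obtain ⟨m, rfl⟩ : ∃ m, n = m + 2 := ⟨n - 2, by omega⟩
  induction e using Sym2.ind with | _ u v => ?_
  have huv : G.Adj u v := he
  have hle : H ≤ G := hH ▸ SimpleGraph.deleteEdges_le _
  set d : Fin (m+2) → ℝ := Pi.single u 1 - Pi.single v 1 with hd
  set s : Fin (m+2) → ℝ := Pi.single u 1 + Pi.single v 1 with hs
  set B := adjMat H - (1/2 : ℝ) • vecMulVec d d with hB
  have hGB : adjMat G = B + (1/2 : ℝ) • vecMulVec s s := by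
    rw [hB, hH]; exact adjMat_delete G u v huv
  have hBh : B.IsHermitian := by
    refine (adjMat_herm H).sub ?_
    ext i j
    simp [vecMulVec_apply, mul_comm]
  obtain ⟨μ, hμ, hBs, hBr⟩ := exists_spec (by omega) B hBh
  have hGs := specData_of_roots (by omega) _ (adjMat_herm G) lam hlam_mono hlam
  have hHs := specData_of_roots (by omega) _ (adjMat_herm H) θ hθ_mono hθ
  have qB : ∀ x, x ⬝ᵥ B *ᵥ x = x ⬝ᵥ adjMat H *ᵥ x - 1/2 * (d ⬝ᵥ x)^2 := by
    intro x
    rw [hB, sub_mulVec, dotProduct_sub, smul_mulVec, dotProduct_smul, quad_rank_one, smul_eq_mul]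
  have qG : ∀ x, x ⬝ᵥ adjMat G *ᵥ x = x ⬝ᵥ B *ᵥ x + 1/2 * (s ⬝ᵥ x)^2 := by
    intro x
    rw [hGB, add_mulVec, dotProduct_add, smul_mulVec, dotProduct_smul, quad_rank_one, smul_eq_mul]
  have h1 : ∀ i < m + 2, μ i ≤ θ i := fun i hi =>
    weyl B (adjMat H) μ θ hμ hθ_mono hBs hHs 0 Fin.elim0
      (fun x _ => by rw [qB]; nlinarith [sq_nonneg (d ⬝ᵥ x)]) i hi
  have h2 : ∀ i, i + 1 < m + 2 → θ (i+1) ≤ μ i := fun i hi =>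
    weyl (adjMat H) B θ μ hθ_mono hμ hHs hBs 1
      (fun _ => dotProductBilin ℝ ℝ d)
      (fun x hx => by
        have : d ⬝ᵥ x = 0 := hx 0
        rw [qB, this]; simp) i hi
  have h3 : ∀ i < m + 2, μ i ≤ lam i := fun i hi =>
    weyl B (adjMat G) μ lam hμ hlam_mono hBs hGs 0 Fin.elim0
      (fun x _ => by rw [qG]; nlinarith [sq_nonneg (s ⬝ᵥ x)]) i hi
  have h0 : θ 0 ≤ lam 0 :=
    top_eig (adjMat H) (adjMat G) θ lam hθ_mono hlam_mono hHs hGs (by omega) (fun x i => |x i|)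
      (fun x => by simp [dotProduct]) (abs_quad G H hle)
  have hsum : ∑ i ∈ Finset.range (m+2), (θ i - μ i) = 1 := by
    rw [Finset.sum_sub_distrib, ← trace_of_roots _ (adjMat_herm H) θ hθ, ← trace_of_roots _ hBh μ hBr,
      hB, trace_sub, trace_smul, trace_vecMulVec]
    have hne := huv.ne
    simp [hd, hne, hne.symm]
    norm_num
  have key := numeric m θ μ lam h1 h2 h3 h0 hsum
  rw [sPlus_eq G lam hlam, sPlus_eq H θ hθ]
  constructor
  · intro _
    have := key 0 le_rfl hpos.le
    rw [sub_zero] at this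
    linarith
  · intro h
    have := key (θ 1 - 1) (by linarith) (by linarith)
    rw [show θ 1 - (θ 1 - 1) = 1 by ring] at this
    linarith
end

section
/- For each fixed real number p with 1 ≤ p < 3, there exists a connected simple graph G and a pair of nonadjacent vertices u, v of G such that E_p^+(G + uv) < E_p^+(G). In fact, for each such p there exists a positive integer n₀ such that for all n ≥ n₀, E_p^+((S̄_{n,n})⁺) < E_p^+(S̄_{n,n}). -/
open Polynomial

/-- Positive `p`-energy: the sum of the `p`-th powers of the positive eigenvalues of the
adjacency matrix. -/
noncomputable def posEnergy {V : Type*} [Fintype V] [DecidableEq V]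
    (G : SimpleGraph V) (p : ℝ) : ℝ :=
  (((adjMat G).charpoly.roots.filter (fun x : ℝ => 0 < x)).map (fun x : ℝ => x ^ p)).sum

/-- The double star `S_{n,n}`: two stars `K_{1,n-1}` with centers `Sum.inl none` and
`Sum.inr none`, joined by an edge between the two centers. It has `2n` vertices when `n ≥ 1`. -/
def doubleStar (n : ℕ) : SimpleGraph (Option (Fin (n - 1)) ⊕ Option (Fin (n - 1))) :=
  SimpleGraph.fromRel (fun a b =>
    (a = Sum.inl none ∧ ∃ i, b = Sum.inl (some i)) ∨
    (a = Sum.inr none ∧ ∃ i, b = Sum.inr (some i)) ∨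
    (a = Sum.inl none ∧ b = Sum.inr none))

/-- `(S̄_{n,n})⁺`: the complement of the double star with the edge `v₁v₂` between the two
centers added. -/
def doubleStarCompPlus (n : ℕ) :
    SimpleGraph (Option (Fin (n - 1)) ⊕ Option (Fin (n - 1))) :=
  (doubleStar n)ᶜ ⊔ SimpleGraph.fromEdgeSet {s(Sum.inl none, Sum.inr none)}

def cls (k : ℕ) : Option (Fin k) ⊕ Option (Fin k) → Fin 4
  | Sum.inl none => 0
  | Sum.inr none => 1
  | Sum.inl (some _) => 2
  | Sum.inr (some _) => 3

def Bq (ε : ℝ) : Matrix (Fin 4) (Fin 4) ℝ :=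
  !![1, ε, 0, 1; ε, 1, 1, 0; 0, 1, 1, 1; 1, 0, 1, 1]

def Uq (k : ℕ) : Matrix (Option (Fin k) ⊕ Option (Fin k)) (Fin 4) ℝ :=
  fun v a => if cls k v = a then 1 else 0

lemma UtU (k : ℕ) : (Uq k).transpose * Uq k = Matrix.diagonal ![1, 1, (k : ℝ), k] := by
  ext a b
  rw [Matrix.mul_apply]
  simp only [Matrix.transpose_apply, Uq, Fintype.sum_sum_type, Fintype.sum_option, cls]
  fin_cases a <;> fin_cases b <;> simp

lemma quot_charpoly (ε : ℝ) (k : ℝ) :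
    (Bq ε * Matrix.diagonal ![1, 1, k, k]).charpoly =
      ((X - C (1 + ε)) * (X - C (2 * k)) - C k) * ((X - C (1 - ε)) * X - C k) := by
  have : Bq ε * Matrix.diagonal ![1, 1, k, k] =
      !![1, ε, 0, k; ε, 1, k, 0; 0, 1, k, k; 1, 0, k, k] := by
    ext a b
    rw [Matrix.mul_diagonal]
    fin_cases a <;> fin_cases b <;> simp [Bq]
  have h2 : Matrix.charmatrix !![1, ε, 0, k; ε, 1, k, 0; 0, 1, k, k; 1, 0, k, k] =
      !![X - 1, -C ε, 0, -C k; -C ε, X - 1, -C k, 0; 0, -1, X - C k, -C k;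
        -1, 0, -C k, X - C k] := by
    ext1 a b
    fin_cases a <;> fin_cases b <;> simp
  rw [this, Matrix.charpoly, h2]
  simp [Matrix.det_succ_row_zero, Fin.sum_univ_succ, Fin.succAbove]
  have hC2 : (C 2 : ℝ[X]) = 2 := rfl
  rw [hC2]
  ring

lemma charpoly_add_one_sub {V : Type*} [Fintype V] [DecidableEq V] (A : Matrix V V ℝ) :
    A.charpoly = (A + 1).charpoly.comp (X + 1) := by
  have h := Matrix.charpoly_sub_scalar (A + 1) 1
  simpa using h

lemma charpoly_of_cls (k : ℕ) (hk : 1 ≤ k) (ε : ℝ)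
    (A : Matrix (Option (Fin k) ⊕ Option (Fin k)) (Option (Fin k) ⊕ Option (Fin k)) ℝ)
    (hA : ∀ i j, (A + 1) i j = Bq ε (cls k i) (cls k j)) :
    A.charpoly = (X + 1) ^ (2 * k - 2) *
      (((X - C ε) * (X - C (2 * (k : ℝ) - 1)) - C (k : ℝ)) *
        ((X + C ε) * (X + 1) - C (k : ℝ))) := by
  have h1 : A + 1 = Uq k * (Bq ε * (Uq k).transpose) := by
    ext i j
    rw [hA, Matrix.mul_apply]
    simp [Uq, Matrix.mul_apply]
  have h2 := Matrix.charpoly_mul_comm' (Uq k) (Bq ε * (Uq k).transpose)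
  rw [← h1, Matrix.mul_assoc, UtU, quot_charpoly] at h2
  have hc : Fintype.card (Option (Fin k) ⊕ Option (Fin k)) = 4 + (2 * k - 2) := by
    simp; omega
  rw [hc, Fintype.card_fin, pow_add, mul_assoc] at h2
  have h3 := mul_left_cancel₀ (pow_ne_zero 4 X_ne_zero) h2
  rw [charpoly_add_one_sub, h3]
  simp only [mul_comp, pow_comp, sub_comp, X_comp, C_comp]
  refine congrArg (fun q => (X + 1) ^ (2 * k - 2) * q) ?_
  simp only [C_add, C_sub, C_mul, C_1]
  ring

open Multiset in
lemma energy_of_factor {V : Type*} [Fintype V] [DecidableEq V] (G : SimpleGraph V) (p : ℝ)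
    (N : ℕ) (a b c d : ℝ)
    (h : (adjMat G).charpoly = (X + 1) ^ N * (((X - C a) * (X - C b)) * ((X - C c) * (X - C d)))) :
    posEnergy G p = (((({a, b, c, d} : Multiset ℝ).filter (fun x : ℝ => 0 < x)).map
      (fun x : ℝ => x ^ p)).sum) := by
  have e : (X + 1 : ℝ[X]) = X - C (-1) := by simp
  have hr : (adjMat G).charpoly.roots = N • {(-1 : ℝ)} + {a, b, c, d} := by
    rw [h, e]
    have q1 := X_sub_C_ne_zero (-1 : ℝ)
    have qa := X_sub_C_ne_zero a
    have qb := X_sub_C_ne_zero b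
    have qc := X_sub_C_ne_zero c
    have qd := X_sub_C_ne_zero d
    rw [roots_mul (by positivity), roots_mul (by positivity), roots_mul (by positivity),
      roots_mul (by positivity), roots_pow]
    simp only [roots_X_sub_C]
    rfl
  rw [posEnergy, hr, Multiset.filter_add]
  have : Multiset.filter (fun x : ℝ => 0 < x) (N • {(-1 : ℝ)}) = 0 := by
    rw [Multiset.filter_eq_nil]
    intro x hx
    have := Multiset.mem_of_mem_nsmul hx
    simp at this
    subst this
    norm_num
  rw [this, zero_add]

open Classical in
lemma adjMat_apply' {V : Type*} [Fintype V] (G : SimpleGraph V) (i j : V) :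
    adjMat G i j = if G.Adj i j then 1 else 0 := by
  simp [adjMat, SimpleGraph.adjMatrix_apply]

lemma adj_compl (k : ℕ) (i j) :
    (adjMat (doubleStar (k + 1))ᶜ + 1) i j = Bq 0 (cls k i) (cls k j) := by
  rcases i with (_ | i) | (_ | i) <;> rcases j with (_ | j) | (_ | j) <;>
    simp [adjMat_apply', doubleStar, cls, Bq, Matrix.one_apply] <;>
    (by_cases h : i = j <;> simp [h])

lemma adj_plus (k : ℕ) (i j) :
    (adjMat (doubleStarCompPlus (k + 1)) + 1) i j = Bq 1 (cls k i) (cls k j) := by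
  rcases i with (_ | i) | (_ | i) <;> rcases j with (_ | j) | (_ | j) <;>
    simp [adjMat_apply', doubleStarCompPlus, doubleStar, cls, Bq, Matrix.one_apply] <;>
    (by_cases h : i = j <;> simp [h])

lemma quad (a b c d k : ℝ) (h1 : a + b = c + d) (h2 : a * b - k = c * d) :
    (X - C a) * (X - C b) - C k = (X - C c) * (X - C d) := by
  have e : ∀ a b : ℝ, (X - C a) * (X - C b) = X ^ 2 - C (a + b) * X + C (a * b) := by
    intro a b; simp only [C_add, C_mul]; ring
  rw [e, e, h1, ← h2, C_sub]
  ring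

lemma energy_compl (k : ℕ) (hk : 1 ≤ k) (p : ℝ) :
    posEnergy (doubleStar (k + 1))ᶜ p =
      ((2 * k - 1 + √(4 * k ^ 2 + 1)) / 2) ^ p + ((-1 + √(4 * k + 1)) / 2) ^ p := by
  have hk' : (1 : ℝ) ≤ k := by exact_mod_cast hk
  have s1 : √(4 * (k : ℝ) ^ 2 + 1) ^ 2 = 4 * k ^ 2 + 1 := Real.sq_sqrt (by positivity)
  have s2 : √(4 * (k : ℝ) + 1) ^ 2 = 4 * k + 1 := Real.sq_sqrt (by positivity)
  have n1 := Real.sqrt_nonneg (4 * (k : ℝ) ^ 2 + 1)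
  have n2 := Real.sqrt_nonneg (4 * (k : ℝ) + 1)
  have h := charpoly_of_cls k hk 0 _ (adj_compl k)
  rw [energy_of_factor (doubleStar (k + 1))ᶜ p (2 * k - 2)
    ((2 * k - 1 + √(4 * k ^ 2 + 1)) / 2) ((2 * k - 1 - √(4 * k ^ 2 + 1)) / 2)
    ((-1 + √(4 * k + 1)) / 2) ((-1 - √(4 * k + 1)) / 2)]
  · have p1 : 0 < (2 * k - 1 + √(4 * (k:ℝ) ^ 2 + 1)) / 2 := by linarith
    have p2 : ¬ 0 < (2 * k - 1 - √(4 * (k:ℝ) ^ 2 + 1)) / 2 := by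
      have : 2 * (k : ℝ) ≤ √(4 * (k:ℝ) ^ 2 + 1) := Real.le_sqrt_of_sq_le (by nlinarith)
      linarith
    have p3 : 0 < (-1 + √(4 * (k:ℝ) + 1)) / 2 := by
      have : 1 < √(4 * (k:ℝ) + 1) := Real.lt_sqrt_of_sq_lt (by nlinarith)
      linarith
    have p4 : ¬ 0 < (-1 - √(4 * (k:ℝ) + 1)) / 2 := by linarith
    simp only [Multiset.insert_eq_cons, Multiset.filter_cons, Multiset.filter_singleton,
      p1, p2, p3, p4, if_true, if_false]
    simp
  · refine h.trans ?_
    congr 2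
    · generalize √(4 * (k : ℝ) ^ 2 + 1) = s at *
      apply quad <;> nlinarith
    · generalize √(4 * (k : ℝ) + 1) = s at *
      have e1 : (X + C (0:ℝ)) * (X + 1) = (X - C 0) * (X - C (-1)) := by simp
      rw [e1]
      apply quad <;> nlinarith

lemma energy_plus (k : ℕ) (hk : 4 ≤ k) (p : ℝ) :
    posEnergy (doubleStarCompPlus (k + 1)) p =
      (k + √(k ^ 2 - k + 1)) ^ p + ((k - √(k ^ 2 - k + 1)) ^ p + (√k - 1) ^ p) := by
  have hk' : (4 : ℝ) ≤ k := by exact_mod_cast hk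
  have s1 : √((k : ℝ) ^ 2 - k + 1) ^ 2 = k ^ 2 - k + 1 := Real.sq_sqrt (by nlinarith)
  have s2 : √(k : ℝ) ^ 2 = k := Real.sq_sqrt (by positivity)
  have n1 := Real.sqrt_nonneg ((k : ℝ) ^ 2 - k + 1)
  have n2 := Real.sqrt_nonneg (k : ℝ)
  have h := charpoly_of_cls k (by omega) 1 _ (adj_plus k)
  rw [energy_of_factor (doubleStarCompPlus (k + 1)) p (2 * k - 2)
    (k + √(k ^ 2 - k + 1)) (k - √(k ^ 2 - k + 1)) (√k - 1) (-√k - 1)]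
  · have p1 : 0 < k + √((k:ℝ) ^ 2 - k + 1) := by linarith
    have p2 : 0 < k - √((k:ℝ) ^ 2 - k + 1) := by
      have : √((k:ℝ) ^ 2 - k + 1) < k := (Real.sqrt_lt' (by linarith)).2 (by linarith)
      linarith
    have p3 : 0 < √(k:ℝ) - 1 := by
      have : 1 < √(k:ℝ) := Real.lt_sqrt_of_sq_lt (by linarith)
      linarith
    have p4 : ¬ 0 < -√(k:ℝ) - 1 := by linarith
    simp only [Multiset.insert_eq_cons, Multiset.filter_cons, Multiset.filter_singleton,
      p1, p2, p3, p4, if_true, if_false]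
    simp
    ring
  · refine h.trans ?_
    congr 2
    · generalize √((k : ℝ) ^ 2 - k + 1) = s at *
      apply quad <;> nlinarith
    · generalize √(k : ℝ) = s at *
      have e1 : (X + C (1:ℝ)) * (X + 1) = (X - C (-1)) * (X - C (-1)) := by simp
      rw [e1]
      apply quad <;> nlinarith

lemma tangent (p x y : ℝ) (hp : 1 ≤ p) (hx : 0 < x) (hy : 0 < y) :
    x ^ p + p * x ^ (p - 1) * (y - x) ≤ y ^ p := by
  have h := one_add_mul_self_le_rpow_one_add (s := y / x - 1) (by
    have : 0 < y / x := by positivity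
    linarith) hp
  have e : 1 + (y / x - 1) = y / x := by ring
  rw [e, Real.div_rpow hy.le hx.le, le_div_iff₀ (by positivity)] at h
  have e2 : x ^ p = x ^ (p - 1) * x := by
    rw [← Real.rpow_add_one hx.ne']; simp
  calc _ = (1 + p * (y / x - 1)) * x ^ p := by
        rw [e2]; field_simp
    _ ≤ _ := h

lemma asymp (p : ℝ) (hp1 : 1 < p) (hp3 : p < 3) :
    ∀ᶠ x : ℝ in Filter.atTop, 9 * x ^ (p - 2) + 1 < x ^ ((p - 1) / 2) / 8 := by
  have t1 : Filter.Tendsto (fun x : ℝ => x ^ (-((3 - p) / 2))) Filter.atTop (nhds 0) :=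
    tendsto_rpow_neg_atTop (by linarith)
  have t2 : Filter.Tendsto (fun x : ℝ => x ^ ((p - 1) / 2)) Filter.atTop Filter.atTop :=
    tendsto_rpow_atTop (by linarith)
  filter_upwards [t1.eventually_lt_const (show (0:ℝ) < 1 / 144 by norm_num),
    t2.eventually_gt_atTop 16, Filter.eventually_gt_atTop 0] with x h1 h2 h3
  have : x ^ (p - 2) = x ^ ((p - 1) / 2) * x ^ (-((3 - p) / 2)) := by
    rw [← Real.rpow_add h3]; congr 1; ring
  rw [this]
  nlinarith

lemma ineq_one (k : ℝ) (hk : 4 ≤ k) :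
    (k + √(k ^ 2 - k + 1)) ^ (1:ℝ) + ((k - √(k ^ 2 - k + 1)) ^ (1:ℝ) + (√k - 1) ^ (1:ℝ)) <
      ((2 * k - 1 + √(4 * k ^ 2 + 1)) / 2) ^ (1:ℝ) + ((-1 + √(4 * k + 1)) / 2) ^ (1:ℝ) := by
  simp only [Real.rpow_one]
  have h1 : 2 * k < √(4 * k ^ 2 + 1) := Real.lt_sqrt_of_sq_lt (by nlinarith)
  have h2 : 2 * √k < √(4 * k + 1) := Real.lt_sqrt_of_sq_lt (by
    have := Real.sq_sqrt (show 0 ≤ k by linarith)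
    nlinarith)
  linarith

lemma ineq_gt (p k : ℝ) (hp1 : 1 < p) (hp3 : p < 3) (hk : 4 ≤ k)
    (has : 9 * k ^ (p - 2) + 1 < k ^ ((p - 1) / 2) / 8) :
    (k + √(k ^ 2 - k + 1)) ^ p + ((k - √(k ^ 2 - k + 1)) ^ p + (√k - 1) ^ p) <
      ((2 * k - 1 + √(4 * k ^ 2 + 1)) / 2) ^ p + ((-1 + √(4 * k + 1)) / 2) ^ p := by
  have k0 : 0 < k := by linarith
  have h1 : 2 * k < √(4 * k ^ 2 + 1) := Real.lt_sqrt_of_sq_lt (by nlinarith)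
  have h2 : 2 * √k < √(4 * k + 1) := Real.lt_sqrt_of_sq_lt (by
    have := Real.sq_sqrt (show 0 ≤ k by linarith)
    nlinarith)
  have h3 : 2 ≤ √k := Real.le_sqrt_of_sq_le (by linarith)
  have h4 : √(k ^ 2 - k + 1) ≤ k - 1 / 2 + 3 / (4 * k) := by
    apply Real.sqrt_le_iff.2
    have : 3 / (4 * k) * k = 3 / 4 := by field_simp
    have q : 0 ≤ 3 / (4 * k) := by positivity
    constructor
    · linarith
    · nlinarith
  have h5 : √(k ^ 2 - k + 1) < k := (Real.sqrt_lt' (by linarith)).2 (by nlinarith)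
  have h6 : k - 1 ≤ √(k ^ 2 - k + 1) := Real.le_sqrt_of_sq_le (by nlinarith)
  set s := √(k ^ 2 - k + 1)
  have a0 : 0 < k + s := by linarith
  have T1 := tangent p (k + s) ((2 * k - 1 + √(4 * k ^ 2 + 1)) / 2) hp1.le a0 (by linarith)
  have T2 := tangent p (√k - 1) ((-1 + √(4 * k + 1)) / 2) hp1.le (by linarith) (by linarith)
  have E1 : (k - s) ^ p ≤ 1 := Real.rpow_le_one (by linarith) (by linarith) (by linarith)
  -- first bound
  have B1 : p * (k + s) ^ (p - 1) * ((k + s) - (2 * k - 1 + √(4 * k ^ 2 + 1)) / 2)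
      ≤ 9 * k ^ (p - 2) := by
    have c1 : (k + s) ^ (p - 1) ≤ 4 * k ^ (p - 1) := by
      calc (k + s) ^ (p - 1) ≤ (2 * k) ^ (p - 1) :=
            Real.rpow_le_rpow a0.le (by linarith) (by linarith)
        _ = 2 ^ (p - 1) * k ^ (p - 1) := Real.mul_rpow (by norm_num) k0.le
        _ ≤ 4 * k ^ (p - 1) := by
            gcongr
            calc (2:ℝ) ^ (p - 1) ≤ 2 ^ (2:ℝ) :=
                  Real.rpow_le_rpow_of_exponent_le (by norm_num) (by linarith)
              _ = 4 := by norm_num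
    have c2 : k ^ (p - 1) = k ^ (p - 2) * k := by
      rw [← Real.rpow_add_one k0.ne']; congr 1; ring
    calc p * (k + s) ^ (p - 1) * ((k + s) - (2 * k - 1 + √(4 * k ^ 2 + 1)) / 2)
        ≤ p * (k + s) ^ (p - 1) * (3 / (4 * k)) := by gcongr; linarith
      _ ≤ 3 * (4 * k ^ (p - 1)) * (3 / (4 * k)) := by gcongr
      _ = 9 * k ^ (p - 2) := by rw [c2]; field_simp; norm_num
  have B2 : k ^ ((p - 1) / 2) / 8 ≤
      p * (√k - 1) ^ (p - 1) * ((-1 + √(4 * k + 1)) / 2 - (√k - 1)) := by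
    have c1 : k ^ ((p - 1) / 2) / 4 ≤ (√k - 1) ^ (p - 1) := by
      calc k ^ ((p - 1) / 2) / 4 = √k ^ (p - 1) / 4 := by
            rw [Real.sqrt_eq_rpow, ← Real.rpow_mul k0.le]; congr 2; ring
        _ ≤ √k ^ (p - 1) / 2 ^ (p - 1) := by
            gcongr
            calc (2:ℝ) ^ (p - 1) ≤ 2 ^ (2:ℝ) :=
                  Real.rpow_le_rpow_of_exponent_le (by norm_num) (by linarith)
              _ = 4 := by norm_num
        _ = (√k / 2) ^ (p - 1) := (Real.div_rpow (by positivity) (by norm_num) _).symm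
        _ ≤ _ := Real.rpow_le_rpow (by positivity) (by linarith) (by linarith)
    calc k ^ ((p - 1) / 2) / 8 = 1 * (k ^ ((p - 1) / 2) / 4) * (1 / 2) := by ring
      _ ≤ _ := by
        have q0 : 0 ≤ (√k - 1) ^ (p - 1) := Real.rpow_nonneg (by linarith) _
        have q1 : 0 ≤ p * (√k - 1) ^ (p - 1) := by positivity
        apply mul_le_mul (mul_le_mul hp1.le c1 (by positivity) (by linarith)) (by linarith) (by norm_num) q1
  nlinarith

lemma main_ineq (p : ℝ) (hp1 : 1 ≤ p) (hp3 : p < 3) :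
    ∃ K : ℕ, 4 ≤ K ∧ ∀ k : ℕ, K ≤ k →
    ((k:ℝ) + √(k ^ 2 - k + 1)) ^ p + ((k - √(k ^ 2 - k + 1)) ^ p + (√k - 1) ^ p) <
      ((2 * k - 1 + √(4 * k ^ 2 + 1)) / 2) ^ p + ((-1 + √(4 * k + 1)) / 2) ^ p := by
  rcases hp1.eq_or_lt with rfl | h
  · exact ⟨4, le_rfl, fun k hk => ineq_one k (by exact_mod_cast hk)⟩
  · obtain ⟨K, hK⟩ := Filter.eventually_atTop.1
      (tendsto_natCast_atTop_atTop.eventually (asymp p h hp3))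
    refine ⟨max K 4, le_max_right _ _, fun k hk => ineq_gt p k h hp3 ?_ (hK k ?_)⟩
    · exact_mod_cast (le_max_right _ _).trans hk
    · exact (le_max_left _ _).trans hk

lemma connected_compl (k : ℕ) (hk : 1 ≤ k) : ((doubleStar (k + 1))ᶜ).Connected := by
  let z : Fin k := ⟨0, hk⟩
  have A : ∀ v : Option (Fin k) ⊕ Option (Fin k),
      (doubleStar (k + 1))ᶜ.Reachable (Sum.inl (some z)) v := by
    have L : ∀ j : Fin k, (doubleStar (k + 1))ᶜ.Reachable (Sum.inl (some z)) (Sum.inr (some j)) := by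
      intro j
      apply SimpleGraph.Adj.reachable
      simp [doubleStar]
    rintro ((_ | i) | (_ | i))
    · refine (L z).trans (SimpleGraph.Adj.reachable ?_)
      simp [doubleStar]
    · refine (L z).trans (SimpleGraph.Adj.reachable ?_)
      simp [doubleStar]
    · apply SimpleGraph.Adj.reachable
      simp [doubleStar]
    · exact L i
  exact { preconnected := fun u v => (A u).symm.trans (A v), nonempty := ⟨Sum.inl none⟩ }

lemma posEnergy_iso {V W : Type*} [Fintype V] [DecidableEq V] [Fintype W] [DecidableEq W]
    (e : W ≃ V) (G : SimpleGraph V) (p : ℝ) : posEnergy (G.comap e) p = posEnergy G p := by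
  have : adjMat (G.comap e) = Matrix.reindex e.symm e.symm (adjMat G) := by
    ext i j
    simp only [adjMat_apply', Matrix.reindex_apply, Matrix.submatrix_apply, Equiv.symm_symm]
    rfl
  rw [posEnergy, posEnergy, this, Matrix.charpoly_reindex]

/-- For each real `1 ≤ p < 3` there is a connected simple graph `G` with
nonadjacent vertices `u ≠ v` such that `E_p^+(G + uv) < E_p^+(G)`; in fact, there is `n₀ > 0`
such that for all `n ≥ n₀`, `E_p^+((S̄_{n,n})⁺) < E_p^+(S̄_{n,n})`. -/
theorem posEnergy_not_monotone (p : ℝ) (hp1 : 1 ≤ p) (hp3 : p < 3) :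
    (∃ (m : ℕ) (G : SimpleGraph (Fin m)) (u v : Fin m),
      G.Connected ∧ u ≠ v ∧ ¬ G.Adj u v ∧
      posEnergy (G ⊔ SimpleGraph.fromEdgeSet {s(u, v)}) p < posEnergy G p) ∧
    (∃ n₀ : ℕ, 0 < n₀ ∧ ∀ n : ℕ, n₀ ≤ n →
      posEnergy (doubleStarCompPlus n) p < posEnergy ((doubleStar n)ᶜ) p) := by
  obtain ⟨K, hK4, hK⟩ := main_ineq p hp1 hp3
  have main : ∀ k : ℕ, K ≤ k →
      posEnergy (doubleStarCompPlus (k + 1)) p < posEnergy ((doubleStar (k + 1))ᶜ) p := by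
    intro k hk
    rw [energy_plus k (by omega), energy_compl k (by omega)]
    exact hK k hk
  refine ⟨?_, K + 1, by omega, ?_⟩
  · let e := (Fintype.equivFin (Option (Fin K) ⊕ Option (Fin K))).symm
    have iso : ((doubleStar (K + 1))ᶜ.comap e) ≃g (doubleStar (K + 1))ᶜ :=
      SimpleGraph.Iso.comap e _
    refine ⟨_, (doubleStar (K + 1))ᶜ.comap e, e.symm (Sum.inl none), e.symm (Sum.inr none),
      iso.connected_iff.2 (connected_compl K (by omega)), by simp, by simp [doubleStar], ?_⟩
    have : (doubleStar (K + 1))ᶜ.comap e ⊔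
        SimpleGraph.fromEdgeSet {s(e.symm (Sum.inl none), e.symm (Sum.inr none))} =
        (doubleStarCompPlus (K + 1)).comap e := by
      ext i j
      obtain ⟨i, rfl⟩ := e.symm.surjective i
      obtain ⟨j, rfl⟩ := e.symm.surjective j
      simp [doubleStarCompPlus]
    rw [this]
    exact (posEnergy_iso e _ p).trans_lt ((main K le_rfl).trans_eq (posEnergy_iso e _ p).symm)
  · intro n hn
    obtain ⟨k, rfl⟩ : ∃ k, n = k + 1 := ⟨n - 1, by omega⟩
    exact main k (by omega)
end
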